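/- Let E : ℝ²∖{0} → ℝ² be of the form E(q) = f·q^⊥/|q|² + W(q) with f > 0, W continuous, and suppose there is a constant c ∈ [0,1) with |q ∧ W(q)| ≤ f·c for all q ∈ ℝ²∖{0}. Let q : (α,β) → ℝ²∖{0} be a C² solution of q̈(s) = −q̇(s)^⊥ + E(q(s)), and set I₁(s) := |c(s)|²/2, I₂(s) := |v(s)|²/2 where v(s) := q̇(s) and c(s) := q(s) − v(s)^⊥. Then d/ds (I₁(s) − I₂(s)) = q(s) ∧ E(q(s)), and consequently f·(1−c) ≤ d/ds (I₁(s) − I₂(s)) ≤ f·(1+c) for all s; in particular I₁ − I₂ is strictly increasing. -/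

import Mathlib

open Set

noncomputable section

/-- `w^⊥ = (-w₂, w₁)`. -/
def perp (w : ℝ × ℝ) : ℝ × ℝ := (-w.2, w.1)

/-- `w ∧ z = w₁z₂ − w₂z₁`. -/
def wedge (w z : ℝ × ℝ) : ℝ := w.1 * z.2 - w.2 * z.1

theorem wedge_smul_perp_add (a : ℝ) (w z : ℝ × ℝ) :
    wedge w (a • perp w + z) = a * (w.1 ^ 2 + w.2 ^ 2) + wedge w z := by
  simp only [wedge, perp, Prod.fst_add, Prod.snd_add, Prod.smul_fst, Prod.smul_snd, smul_eq_mul]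
  ring

theorem sq_add_sq_pos_of_ne_zero {w : ℝ × ℝ} (hw : w ≠ 0) : 0 < w.1 ^ 2 + w.2 ^ 2 := by
  by_contra! h
  refine hw (Prod.ext ?_ ?_)
  · exact pow_eq_zero_iff two_ne_zero |>.mp (by nlinarith [sq_nonneg w.1, sq_nonneg w.2])
  · exact pow_eq_zero_iff two_ne_zero |>.mp (by nlinarith [sq_nonneg w.1, sq_nonneg w.2])

/-- Along a solution of `q̈ = −q̇^⊥ + F`, the difference of the center action and the energy
changes at the rate `q ∧ F`. -/
theorem hasDerivAt_center_action_sub_energy {q v : ℝ → ℝ × ℝ} {F : ℝ × ℝ} {s : ℝ}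
    (hq : HasDerivAt q (v s) s) (hv : HasDerivAt v (-perp (v s) + F) s) :
    HasDerivAt (fun t => ((q t - perp (v t)).1 ^ 2 + (q t - perp (v t)).2 ^ 2) / 2
      - ((v t).1 ^ 2 + (v t).2 ^ 2) / 2) (wedge (q s) F) s := by
  have hq₁ : HasDerivAt (fun t => (q t).1) (v s).1 s :=
    (ContinuousLinearMap.fst ℝ ℝ ℝ).hasFDerivAt.comp_hasDerivAt s hq
  have hq₂ : HasDerivAt (fun t => (q t).2) (v s).2 s :=
    (ContinuousLinearMap.snd ℝ ℝ ℝ).hasFDerivAt.comp_hasDerivAt s hq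
  have hv₁ : HasDerivAt (fun t => (v t).1) (-perp (v s) + F).1 s :=
    (ContinuousLinearMap.fst ℝ ℝ ℝ).hasFDerivAt.comp_hasDerivAt s hv
  have hv₂ : HasDerivAt (fun t => (v t).2) (-perp (v s) + F).2 s :=
    (ContinuousLinearMap.snd ℝ ℝ ℝ).hasFDerivAt.comp_hasDerivAt s hv
  have h := ((((hq₁.pow 2).add (hq₂.pow 2)).div_const 2).add (hq₁.mul hv₂)).sub (hq₂.mul hv₁)
  refine (h.congr_deriv ?_).congr_of_eventuallyEq (.of_forall fun t => ?_)
  · simp only [wedge, perp, Prod.fst_add, Prod.snd_add, Prod.fst_neg, Prod.snd_neg]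
    push_cast
    ring
  · simp only [perp, Prod.fst_sub, Prod.snd_sub, Pi.add_apply, Pi.sub_apply, Pi.mul_apply,
      Pi.pow_apply]
    ring

/-- small-torque monotonicity.  For `E(q) = f·q^⊥/|q|² + W(q)` with
`|q ∧ W(q)| ≤ f·c`, `0 ≤ c < 1`, along any C² solution of `q̈ = −q̇^⊥ + E(q)` with values
in `ℝ²∖{0}` one has `d/ds (I₁ − I₂) = q ∧ E(q)` with
`f(1−c) ≤ d/ds (I₁ − I₂) ≤ f(1+c)`; in particular `I₁ − I₂` is strictly increasing. -/
theorem action_difference_increasing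
    (f : ℝ) (hf : 0 < f)
    (W : ℝ × ℝ → ℝ × ℝ) (hW : ContinuousOn W {q : ℝ × ℝ | q ≠ 0})
    (c : ℝ) (hc0 : 0 ≤ c) (hc1 : c < 1)
    (htorque : ∀ q : ℝ × ℝ, q ≠ 0 → |wedge q (W q)| ≤ f * c)
    (E : ℝ × ℝ → ℝ × ℝ)
    (hE : ∀ q : ℝ × ℝ, q ≠ 0 → E q = (f / (q.1 ^ 2 + q.2 ^ 2)) • perp q + W q)
    (α β : ℝ) (q q' : ℝ → ℝ × ℝ)
    (hq0 : ∀ s ∈ Ioo α β, q s ≠ 0)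
    (hq : ∀ s ∈ Ioo α β, HasDerivAt q (q' s) s)
    (hNewton : ∀ s ∈ Ioo α β, HasDerivAt q' (-perp (q' s) + E (q s)) s)
    (I₁ I₂ : ℝ → ℝ)
    (hI₁ : ∀ s, I₁ s = ((q s - perp (q' s)).1 ^ 2 + (q s - perp (q' s)).2 ^ 2) / 2)
    (hI₂ : ∀ s, I₂ s = ((q' s).1 ^ 2 + (q' s).2 ^ 2) / 2) :
    (∀ s ∈ Ioo α β,
      HasDerivAt (fun t => I₁ t - I₂ t) (wedge (q s) (E (q s))) s ∧
      f * (1 - c) ≤ wedge (q s) (E (q s)) ∧ wedge (q s) (E (q s)) ≤ f * (1 + c)) ∧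
    StrictMonoOn (fun s => I₁ s - I₂ s) (Ioo α β) := by
  have hwedge : ∀ s ∈ Ioo α β, wedge (q s) (E (q s)) = f + wedge (q s) (W (q s)) := by
    intro s hs
    rw [hE _ (hq0 s hs), wedge_smul_perp_add,
      div_mul_cancel₀ _ (sq_add_sq_pos_of_ne_zero (hq0 s hs)).ne']
  have main : ∀ s ∈ Ioo α β,
      HasDerivAt (fun t => I₁ t - I₂ t) (wedge (q s) (E (q s))) s ∧
      f * (1 - c) ≤ wedge (q s) (E (q s)) ∧ wedge (q s) (E (q s)) ≤ f * (1 + c) := by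
    intro s hs
    obtain ⟨hlow, hupp⟩ := abs_le.mp (htorque _ (hq0 s hs))
    refine ⟨?_, ?_, ?_⟩
    · simp only [hI₁, hI₂]
      exact hasDerivAt_center_action_sub_energy (hq s hs) (hNewton s hs)
    · rw [hwedge s hs]
      linarith
    · rw [hwedge s hs]
      linarith
  refine ⟨main, strictMonoOn_of_deriv_pos (convex_Ioo α β)
    (fun s hs => (main s hs).1.continuousAt.continuousWithinAt) fun s hs => ?_⟩
  rw [interior_Ioo] at hs
  rw [(main s hs).1.deriv]
  exact (mul_pos hf (sub_pos.mpr hc1)).trans_le (main s hs).2.1
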